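/- arXiv:math/0112227 — 4 statements merged into one kernel-verified Lean document; each statement's English description precedes it below -/
import Mathlib

section
/- Let g ↦ T_g be a free measure-preserving action of a countable discrete abelian group G (written additively) on a standard Borel probability space (X,μ), let S₁ be an invertible measure-preserving transformation of X, let β be a group automorphism of G, let e : X → G be measurable, and let g : G × X → G be a map satisfying: (a) for every h ∈ G and almost every x ∈ X, T_{-h}x = S₁(T_{-g(h,x)}(S₁⁻¹x)); and (b) for every h ∈ G and almost every x ∈ X, g(h,x) = β(e(x)) − β(e(T_{-h}x)) + β(h). Define S₂ : X → X by S₂x = S₁(T_{-β(e(x))}(S₁⁻¹x)). Then, after discarding a μ-null set, S₂ is an invertible measure-preserving transformation of X, and its inverse is given by S₂⁻¹x = T_{e(x)}x for almost every x. -/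
open MeasureTheory Filter

/-- A measurable self-map of a probability space that does not increase the measure of measurable
sets under preimages is measure preserving. -/
theorem measurePreserving_of_measure_preimage_le {X : Type*} [MeasurableSpace X]
    {μ : Measure X} [IsProbabilityMeasure μ] {f : X → X} (hf : Measurable f)
    (hle : ∀ s, MeasurableSet s → μ (f ⁻¹' s) ≤ μ s) : MeasurePreserving f μ μ := by
  have := Measure.isProbabilityMeasure_map (μ := μ) hf.aemeasurable
  refine ⟨hf, Measure.eq_of_le_of_isProbabilityMeasure ?_⟩
  exact Measure.le_iff.2 fun s hs => (Measure.map_apply hf hs).trans_le (hle s hs)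

/-- If `x ↦ F (e x) x`, glued from countably many measure-preserving maps, has a measurable
left inverse almost everywhere, then it is measure preserving. -/
theorem measurePreserving_of_ae_leftInverse {X G : Type*} [MeasurableSpace X] [Countable G]
    [MeasurableSpace G] [MeasurableSingletonClass G] {μ : Measure X} [IsProbabilityMeasure μ]
    {F : G → X → X} (hF : ∀ g, MeasurePreserving (F g) μ μ) {e : X → G} (he : Measurable e)
    {S : X → X} (hS : Measurable S) (hR : Measurable fun x => F (e x) x)
    (hSR : ∀ᵐ x ∂μ, S (F (e x) x) = x) :
    MeasurePreserving (fun x => F (e x) x) μ μ := by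
  refine measurePreserving_of_measure_preimage_le hR fun C hC => ?_
  have hP (k : G) : MeasurableSet (C ∩ (e ∘ S) ⁻¹' {k}) :=
    hC.inter ((he.comp hS) (measurableSet_singleton k))
  calc μ ((fun x => F (e x) x) ⁻¹' C)
      ≤ μ (⋃ k, F k ⁻¹' (C ∩ (e ∘ S) ⁻¹' {k})) := by
        refine measure_mono_ae ?_
        filter_upwards [hSR] with x hx hxC
        exact Set.mem_iUnion.2 ⟨e x, hxC, congrArg e hx⟩
    _ ≤ ∑' k, μ (F k ⁻¹' (C ∩ (e ∘ S) ⁻¹' {k})) := measure_iUnion_le _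
    _ = ∑' k, μ (C ∩ (e ∘ S) ⁻¹' {k}) :=
        tsum_congr fun k => (hF k).measure_preimage (hP k).nullMeasurableSet
    _ = μ (⋃ k, C ∩ (e ∘ S) ⁻¹' {k}) := by
        refine (measure_iUnion (fun i j hij => ?_) hP).symm
        exact Set.disjoint_left.2 fun x hi hj => hij (hi.2.symm.trans hj.2)
    _ ≤ μ C := measure_mono (Set.iUnion_subset fun k => Set.inter_subset_left)

/-- Let `T` be a free measure-preserving action of a countable
discrete abelian group `G` on a standard Borel probability space, `S₁` an invertible
measure-preserving transformation, `β` an automorphism of `G`, `e : X → G`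
measurable, and `gfun` a map satisfying (a) `T₋ₕ x = S₁ T₋g(h,x) S₁⁻¹ x` a.e. and
(b) `g(h,x) = β(e(x)) − β(e(T₋ₕx)) + β(h)` a.e. Then
`S₂ x = S₁ (T₋β(e(x)) (S₁⁻¹ x))` is, up to a null set, an invertible
measure-preserving transformation whose inverse is `x ↦ T_{e(x)} x`. -/
theorem statement6 {X : Type*} [MeasurableSpace X] [StandardBorelSpace X]
    (μ : Measure X) [IsProbabilityMeasure μ]
    {G : Type*} [AddCommGroup G] [Countable G]
    (T : G → X → X)
    (hTmp : ∀ g, MeasurePreserving (T g) μ μ)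
    (hT0 : ∀ x, T 0 x = x)
    (hTadd : ∀ g h x, T (g + h) x = T g (T h x))
    (hTfree : ∀ g : G, g ≠ 0 → ∀ᵐ x ∂μ, T g x ≠ x)
    (S₁ : X ≃ᵐ X) (hS₁ : MeasurePreserving S₁ μ μ)
    (β : G ≃+ G)
    (e : X → G) (he : ∀ g : G, MeasurableSet {x | e x = g})
    (gfun : G × X → G)
    (ha : ∀ h : G, ∀ᵐ x ∂μ, T (-h) x = S₁ (T (-(gfun (h, x))) (S₁.symm x)))
    (hb : ∀ h : G, ∀ᵐ x ∂μ, gfun (h, x) = β (e x) - β (e (T (-h) x)) + β h)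
    (S₂ : X → X) (hS₂ : ∀ x, S₂ x = S₁ (T (-(β (e x))) (S₁.symm x))) :
    Measure.map S₂ μ = μ ∧
      (∀ᵐ x ∂μ, S₂ (T (e x) x) = x) ∧
      (∀ᵐ x ∂μ, T (e (S₂ x)) (S₂ x) = x) := by
  let _ : MeasurableSpace G := ⊤
  have he_meas : Measurable e := measurable_to_countable' he
  have hT_meas : Measurable fun p : G × X => T p.1 p.2 :=
    measurable_from_prod_countable_right fun g => (hTmp g).measurable
  have hR : Measurable fun x => T (e x) x := hT_meas.comp (he_meas.prodMk measurable_id)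
  have hS : Measurable S₂ := by
    rw [funext hS₂]
    exact S₁.measurable.comp (hT_meas.comp
      (((measurable_from_top (f := fun g : G => -(β g))).comp he_meas).prodMk S₁.symm.measurable))
  have hSR : ∀ᵐ x ∂μ, S₂ (T (e x) x) = x := by
    filter_upwards [ae_all_iff.2 ha, ae_all_iff.2 hb] with x hax hbx
    have hT := hax (-e x)
    have hg : gfun (-e x, x) = -β (e (T (e x) x)) := by
      rw [hbx (-e x), neg_neg, map_neg]
      abel
    rw [hg, neg_neg, neg_neg] at hT
    have hsymm : S₁.symm (T (e x) x) = T (β (e (T (e x) x))) (S₁.symm x) := by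
      rw [MeasurableEquiv.symm_apply_eq]
      exact hT
    rw [hS₂, hsymm, ← hTadd, neg_add_cancel, hT0, S₁.apply_symm_apply]
  have hRmp := measurePreserving_of_ae_leftInverse hTmp he_meas hS hR hSR
  refine ⟨?_, hSR, ?_⟩
  · calc Measure.map S₂ μ = Measure.map S₂ (Measure.map (fun x => T (e x) x) μ) := by
          rw [hRmp.map_eq]
      _ = Measure.map (S₂ ∘ fun x => T (e x) x) μ := Measure.map_map hS hR
      _ = Measure.map id μ := Measure.map_congr hSR
      _ = μ := Measure.map_id
  · have hset : MeasurableSet {y | T (e (S₂ y)) (S₂ y) = y} :=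
      measurableSet_eq_fun (hR.comp hS) measurable_id
    rw [← hRmp.map_eq, ae_map_iff hR.aemeasurable hset]
    filter_upwards [hSR] with x hx
    simp only [hx]
end

section
/- Let g ↦ T_g be a free measure-preserving action of a countable discrete abelian group G (written additively) on a standard Borel probability space (X,μ), let S₁ be an invertible measure-preserving transformation of X, let β be a group automorphism of G, let e : X → G be measurable, and let g : G × X → G be a map satisfying: (a) for every h ∈ G and almost every x ∈ X, T_{-h}x = S₁(T_{-g(h,x)}(S₁⁻¹x)); and (b) for every h ∈ G and almost every x ∈ X, g(h,x) = β(e(x)) − β(e(T_{-h}x)) + β(h). Define S : X → X by Sx = T_{e(S₁x)}(S₁x) (that is, S = S₂⁻¹∘S₁, where S₂x = S₁(T_{-β(e(x))}(S₁⁻¹x))). Then S is an invertible measure-preserving transformation of X (after discarding a μ-null set) and for every g ∈ G and almost every x ∈ X one has T_g(Sx) = S(T_{β(g)}x). -/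
open MeasureTheory Filter

namespace CountableAction

variable {X G : Type*} [MeasurableSpace X] {μ : Measure X} [Countable G]
  {T : G → X → X} {e : X → G}

/-- A map that moves each point by an element of a countable measurable action, chosen measurably,
is measurable. -/
theorem measurable_translate (hT : ∀ g, Measurable (T g))
    (he : ∀ g : G, MeasurableSet {x | e x = g}) : Measurable fun x => T (e x) x := by
  intro B hB
  have : (fun x => T (e x) x) ⁻¹' B = ⋃ g : G, {x | e x = g} ∩ T g ⁻¹' B := by
    ext x
    simp
  rw [this]
  exact .iUnion fun g => (he g).inter (hT g hB)

variable [AddCommGroup G]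

/-- A piecewise translation preserves the measure of sets on which it is injective. -/
theorem measure_image_translate (hTmp : ∀ g, MeasurePreserving (T g) μ μ)
    (hT0 : ∀ x, T 0 x = x) (hTadd : ∀ g h x, T (g + h) x = T g (T h x))
    (he : ∀ g : G, MeasurableSet {x | e x = g}) {C : Set X} (hC : MeasurableSet C)
    (hinj : Set.InjOn (fun x => T (e x) x) C) :
    MeasurableSet ((fun x => T (e x) x) '' C) ∧ μ ((fun x => T (e x) x) '' C) = μ C := by
  have hneg (g : G) (x : X) : T g (T (-g) x) = x := by rw [← hTadd, add_neg_cancel, hT0]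
  have hneg' (g : G) (x : X) : T (-g) (T g x) = x := by rw [← hTadd, neg_add_cancel, hT0]
  have hCg (g : G) : MeasurableSet (C ∩ {x | e x = g}) := hC.inter (he g)
  have himage : (fun x => T (e x) x) '' C = ⋃ g : G, T (-g) ⁻¹' (C ∩ {x | e x = g}) := by
    ext y
    simp only [Set.mem_image, Set.mem_iUnion, Set.mem_preimage, Set.mem_inter_iff,
      Set.mem_ofPred_eq]
    constructor
    · rintro ⟨x, hx, rfl⟩
      exact ⟨e x, by rwa [hneg'], by rw [hneg']⟩
    · rintro ⟨g, hy, hg⟩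
      exact ⟨_, hy, by rw [hg, hneg]⟩
  have hunion : C = ⋃ g : G, C ∩ {x | e x = g} := by
    ext x
    simp
  have hmeas (g : G) : MeasurableSet (T (-g) ⁻¹' (C ∩ {x | e x = g})) :=
    (hTmp (-g)).measurable (hCg g)
  refine ⟨himage ▸ .iUnion hmeas, ?_⟩
  rw [himage, measure_iUnion _ hmeas]
  · conv_rhs => rw [hunion, measure_iUnion (fun g h hgh => Set.disjoint_left.2 fun x hx hx' =>
      hgh (hx.2.symm.trans hx'.2)) hCg]
    exact tsum_congr fun g => (hTmp (-g)).measure_preimage (hCg g).nullMeasurableSet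
  · refine fun g h hgh => Set.disjoint_left.2 fun y hy hy' => hgh ?_
    have hyg : e (T (-g) y) = g := hy.2
    have hyh : e (T (-h) y) = h := hy'.2
    have hyy := hinj hy.1 hy'.1 (by simp only [hyg, hyh, hneg])
    rw [← hyg, hyy, hyh]

variable [IsProbabilityMeasure μ]

/-- A piecewise translation that is injective on a conull set is onto a conull set. -/
theorem ae_mem_image_translate (hTmp : ∀ g, MeasurePreserving (T g) μ μ)
    (hT0 : ∀ x, T 0 x = x) (hTadd : ∀ g h x, T (g + h) x = T g (T h x))
    (he : ∀ g : G, MeasurableSet {x | e x = g}) {A : Set X} (hA : MeasurableSet A)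
    (hAae : ∀ᵐ x ∂μ, x ∈ A) (hinj : Set.InjOn (fun x => T (e x) x) A) :
    ∀ᵐ y ∂μ, y ∈ (fun x => T (e x) x) '' A := by
  obtain ⟨hm, hμ⟩ := measure_image_translate hTmp hT0 hTadd he hA hinj
  exact (mem_ae_iff_prob_eq_one hm).2 (hμ.trans ((mem_ae_iff_prob_eq_one hA).1 hAae))

/-- A piecewise translation that is injective on a conull set is measure preserving. -/
theorem measurePreserving_translate (hTmp : ∀ g, MeasurePreserving (T g) μ μ)
    (hT0 : ∀ x, T 0 x = x) (hTadd : ∀ g h x, T (g + h) x = T g (T h x))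
    (he : ∀ g : G, MeasurableSet {x | e x = g}) {A : Set X} (hA : MeasurableSet A)
    (hAae : ∀ᵐ x ∂μ, x ∈ A) (hinj : Set.InjOn (fun x => T (e x) x) A) :
    MeasurePreserving (fun x => T (e x) x) μ μ := by
  have hV := measurable_translate (fun g => (hTmp g).measurable) he
  refine ⟨hV, Measure.ext fun B hB => ?_⟩
  have hsurj := ae_mem_image_translate hTmp hT0 hTadd he hA hAae hinj
  rw [Measure.map_apply hV hB, ← measure_inter_conull (t := A) (mem_ae_iff.1 hAae),
    ← measure_inter_conull (s := B) (t := (fun x => T (e x) x) '' A) (mem_ae_iff.1 hsurj),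
    Set.inter_comm _ A,
    ← (measure_image_translate hTmp hT0 hTadd he (hA.inter (hV hB))
      (hinj.mono Set.inter_subset_left)).2, Set.image_inter_preimage, Set.inter_comm]

/-- A piecewise translation of a standard Borel space that is injective on a conull set has a
measurable inverse modulo null sets. -/
theorem exists_ae_inverse_translate [StandardBorelSpace X]
    (hTmp : ∀ g, MeasurePreserving (T g) μ μ)
    (hT0 : ∀ x, T 0 x = x) (hTadd : ∀ g h x, T (g + h) x = T g (T h x))
    (he : ∀ g : G, MeasurableSet {x | e x = g}) {A : Set X} (hA : MeasurableSet A)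
    (hAae : ∀ᵐ x ∂μ, x ∈ A) (hinj : Set.InjOn (fun x => T (e x) x) A) :
    ∃ R : X → X, Measurable R ∧ (∀ᵐ x ∂μ, R (T (e x) x) = x) ∧
      ∀ᵐ x ∂μ, T (e (R x)) (R x) = x := by
  have hV := measurable_translate (fun g => (hTmp g).measurable) he
  have := hA.standardBorel
  have hemb : MeasurableEmbedding (fun x : A => T (e x) x) :=
    (hV.comp measurable_subtype_coe).measurableEmbedding hinj.injective
  obtain ⟨R, hR, hRV⟩ := hemb.exists_measurable_extend measurable_subtype_coe
    (fun _ => nonempty_of_isProbabilityMeasure μ)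
  have hRA (x : X) (hx : x ∈ A) : R (T (e x) x) = x := congrFun hRV ⟨x, hx⟩
  refine ⟨R, hR, hAae.mono hRA, ?_⟩
  filter_upwards [ae_mem_image_translate hTmp hT0 hTadd he hA hAae hinj] with _ ⟨x, hx, hxy⟩
  subst hxy
  simp only [hRA x hx]

end CountableAction

open CountableAction

/-- In the setting of Statement 6, the map `S x = T_{e(S₁x)} (S₁ x)`
(that is, `S = S₂⁻¹ ∘ S₁` with `S₂ x = S₁ (T₋β(e(x)) (S₁⁻¹ x))`) is, up to a null
set, an invertible measure-preserving transformation, and it intertwines the action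
with its composition with `β`: `T_g (S x) = S (T_{β(g)} x)` a.e. for every `g`. -/
theorem statement7 {X : Type*} [MeasurableSpace X] [StandardBorelSpace X]
    (μ : Measure X) [IsProbabilityMeasure μ]
    {G : Type*} [AddCommGroup G] [Countable G]
    (T : G → X → X)
    (hTmp : ∀ g, MeasurePreserving (T g) μ μ)
    (hT0 : ∀ x, T 0 x = x)
    (hTadd : ∀ g h x, T (g + h) x = T g (T h x))
    (hTfree : ∀ g : G, g ≠ 0 → ∀ᵐ x ∂μ, T g x ≠ x)
    (S₁ : X ≃ᵐ X) (hS₁ : MeasurePreserving S₁ μ μ)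
    (β : G ≃+ G)
    (e : X → G) (he : ∀ g : G, MeasurableSet {x | e x = g})
    (gfun : G × X → G)
    (ha : ∀ h : G, ∀ᵐ x ∂μ, T (-h) x = S₁ (T (-(gfun (h, x))) (S₁.symm x)))
    (hb : ∀ h : G, ∀ᵐ x ∂μ, gfun (h, x) = β (e x) - β (e (T (-h) x)) + β h)
    (S : X → X) (hS : ∀ x, S x = T (e (S₁ x)) (S₁ x)) :
    Measure.map S μ = μ ∧
      (∃ R : X → X, Measurable R ∧
        (∀ᵐ x ∂μ, R (S x) = x) ∧ (∀ᵐ x ∂μ, S (R x) = x)) ∧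
      ∀ g : G, ∀ᵐ x ∂μ, T g (S x) = S (T (β g) x) := by
  obtain ⟨A, hAsub, hA, hA0⟩ := exists_measurable_superset_of_null
    (mem_ae_iff.1 ((ae_all_iff.2 ha).and (ae_all_iff.2 hb)))
  replace hAae : ∀ᵐ x ∂μ, x ∈ Aᶜ := by simpa [ae_iff] using hA0
  have hgood (x : X) (hx : x ∈ Aᶜ) (h : G) :
      T (-h) x = S₁ (T (-(gfun (h, x))) (S₁.symm x)) ∧
        gfun (h, x) = β (e x) - β (e (T (-h) x)) + β h := by
    have := Set.notMem_compl_iff.1 fun hx' => hx (hAsub hx')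
    exact ⟨this.1 h, this.2 h⟩
  have key (x : X) (hx : x ∈ Aᶜ) (k : G) (z : X) (hz : T (e z) z = T k (T (e x) x)) :
      z = S₁ (T (β k) (S₁.symm x)) := by
    have hzx : z = T (-(e z - k - e x)) x := by
      rw [← hTadd] at hz
      have := congrArg (T (-e z)) hz
      rw [← hTadd, ← hTadd, neg_add_cancel, hT0] at this
      exact this.trans (congrArg (T · x) (by abel))
    obtain ⟨h1, h2⟩ := hgood x hx (e z - k - e x)
    rw [← hzx] at h1 h2
    rw [h1, h2]
    congr 2
    simp only [map_sub]
    abel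
  have hinj : Set.InjOn (fun x => T (e x) x) Aᶜ := by
    intro x hx z _ hxz
    have := key x hx 0 z (by rw [hT0]; exact hxz.symm)
    simpa [hT0] using this.symm
  have hV := measurePreserving_translate hTmp hT0 hTadd he hA.compl hAae hinj
  have hsurj := ae_mem_image_translate hTmp hT0 hTadd he hA.compl hAae hinj
  obtain ⟨R, hR, hRV, hVR⟩ := exists_ae_inverse_translate hTmp hT0 hTadd he hA.compl hAae hinj
  have hSV : S = (fun x => T (e x) x) ∘ S₁ := funext hS
  refine ⟨hSV ▸ (hV.comp hS₁).map_eq, ⟨S₁.symm ∘ R, S₁.symm.measurable.comp hR, ?_, ?_⟩, ?_⟩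
  · filter_upwards [hS₁.quasiMeasurePreserving.ae hRV] with x hx
    simp [hS, hx]
  · filter_upwards [hVR] with x hx
    simp [hS, hx]
  · intro k
    filter_upwards [hS₁.quasiMeasurePreserving.ae hAae,
      (((hTmp k).comp hV).comp hS₁).quasiMeasurePreserving.ae hsurj] with y hy ⟨z, _, hz⟩
    have hz' : T (e z) z = T k (T (e (S₁ y)) (S₁ y)) := hz
    have := key (S₁ y) hy k z hz'
    rw [S₁.symm_apply_apply] at this
    rw [hS, hS, ← this, hz']
end

section
/- Let g ↦ P_g be a free measure-preserving action of a countable discrete abelian group G on a standard Borel probability space (X,μ), and let Q be an invertible measure-preserving transformation of X. Let X₀ := {x ∈ X : Q⁻¹x ∉ {P_g x : g ∈ G} and P_g x ≠ x for all g ≠ 0}. Then there exists a countable family {X_i}_{i∈I} of measurable subsets of X such that for every finite subset F ⊆ G and almost every x ∈ X₀ there is i ∈ I with: x ∈ X_i, the sets P_g(X_i), g ∈ F, are pairwise disjoint, and Q⁻¹x ∉ ∪_{g∈F} P_g(X_i). -/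
open MeasureTheory Filter

/-- A real number outside a finite set has a rational interval neighbourhood avoiding that set. -/
lemma exists_rat_Ioo_disjoint_finite {S : Set ℝ} (hS : S.Finite) {t : ℝ} (ht : t ∉ S) :
    ∃ a b : ℚ, t ∈ Set.Ioo (a : ℝ) b ∧ ∀ s ∈ S, s ∉ Set.Ioo (a : ℝ) b := by
  obtain ⟨l, u, htlu, hlu⟩ :=
    mem_nhds_iff_exists_Ioo_subset.1 (hS.isClosed.isOpen_compl.mem_nhds ht)
  obtain ⟨a, hla, hat⟩ := exists_rat_btwn htlu.1
  obtain ⟨b, htb, hbu⟩ := exists_rat_btwn htlu.2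
  exact ⟨a, b, ⟨hat, htb⟩, fun s hs hsab => hlu ⟨hla.trans hsab.1, hsab.2.trans hbu⟩ hs⟩

/-- The points of `A` that no nonzero difference of elements of `F` moves back into `A`. -/
def nonreturnSet {X G : Type*} [AddGroup G] (P : G → X → X) (F : Finset G) (A : Set X) :
    Set X :=
  A \ ⋃ g ∈ F, ⋃ g' ∈ F, ⋃ _ : g ≠ g', P (-g' + g) ⁻¹' A

lemma measurableSet_nonreturnSet {X G : Type*} [MeasurableSpace X] [AddGroup G]
    {P : G → X → X} (hP : ∀ g, Measurable (P g)) (F : Finset G) {A : Set X}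
    (hA : MeasurableSet A) : MeasurableSet (nonreturnSet P F A) :=
  hA.diff <| F.measurableSet_biUnion fun _ _ => F.measurableSet_biUnion fun _ _ =>
    MeasurableSet.iUnion fun _ => hP _ hA

lemma disjoint_image_nonreturnSet {X G : Type*} [AddGroup G] {P : G → X → X}
    (hP0 : ∀ x, P 0 x = x) (hPadd : ∀ g h x, P (g + h) x = P g (P h x))
    {F : Finset G} (A : Set X) {g g' : G} (hg : g ∈ F) (hg' : g' ∈ F) (hne : g ≠ g') :
    Disjoint (P g '' nonreturnSet P F A) (P g' '' nonreturnSet P F A) := by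
  rw [Set.disjoint_left]
  rintro _ ⟨u, hu, rfl⟩ ⟨v, hv, huv⟩
  refine hu.2 ?_
  simp only [Set.mem_iUnion, Set.mem_preimage]
  refine ⟨g, hg, g', hg', hne, ?_⟩
  rw [hPadd, ← huv, ← hPadd, neg_add_cancel, hP0]
  exact hv.1

/-- For a free measure-preserving action `P` of a countable discrete
abelian group on a standard Borel probability space and an invertible measure-preserving
transformation `Q`, with `X₀` the set of points `x` such that `Q⁻¹ x` is not on the
`P`-orbit of `x` and `x` has trivial stabilizer, there is a countable family of
measurable sets `Xᵢ` such that for every finite `F ⊆ G` and almost every `x ∈ X₀`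
some `Xᵢ` contains `x`, has pairwise disjoint translates `P g '' Xᵢ` (`g ∈ F`), and
avoids `Q⁻¹ x` in the union of these translates. -/
theorem statement11 {X : Type*} [MeasurableSpace X] [StandardBorelSpace X]
    (μ : Measure X) [IsProbabilityMeasure μ]
    {G : Type*} [AddCommGroup G] [Countable G]
    (P : G → X → X)
    (hPmp : ∀ g, MeasurePreserving (P g) μ μ)
    (hP0 : ∀ x, P 0 x = x)
    (hPadd : ∀ g h x, P (g + h) x = P g (P h x))
    (hPfree : ∀ g : G, g ≠ 0 → ∀ᵐ x ∂μ, P g x ≠ x)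
    (Q : X ≃ᵐ X) (hQ : MeasurePreserving Q μ μ)
    (X₀ : Set X)
    (hX₀ : X₀ = {x : X | (∀ g : G, Q.symm x ≠ P g x) ∧ ∀ g : G, g ≠ 0 → P g x ≠ x}) :
    ∃ (I : Type) (_ : Countable I) (Xi : I → Set X),
      (∀ i, MeasurableSet (Xi i)) ∧
      ∀ F : Finset G, ∀ᵐ x ∂μ, x ∈ X₀ →
        ∃ i : I, x ∈ Xi i ∧
          (∀ g ∈ F, ∀ g' ∈ F, g ≠ g' → Disjoint (P g '' Xi i) (P g' '' Xi i)) ∧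
          Q.symm x ∉ ⋃ g ∈ F, P g '' Xi i := by
  obtain ⟨e, he⟩ := exists_surjective_nat (Finset G)
  let f : X → ℝ := embeddingReal X
  have hf : MeasurableEmbedding f := measurableEmbedding_embeddingReal X
  let A : ℚ → ℚ → Set X := fun a b => f ⁻¹' Set.Ioo (a : ℝ) b
  refine ⟨ℚ × ℚ × ℕ, inferInstance, fun i => nonreturnSet P (e i.2.2) (A i.1 i.2.1),
    fun i => measurableSet_nonreturnSet (fun g => (hPmp g).measurable) _
      (hf.measurable measurableSet_Ioo), fun F => .of_forall fun x hx => ?_⟩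
  rw [hX₀] at hx
  obtain ⟨hQx, hPx⟩ := hx
  obtain ⟨n, rfl⟩ := he F
  let S : Set X := {y | y ≠ x ∧ ((∃ g ∈ e n, ∃ g' ∈ e n, P (-g' + g) x = y) ∨
    ∃ g ∈ e n, P (-g) (Q.symm x) = y)}
  have hS : S.Finite := by
    refine Set.Finite.subset (((Set.Finite.image2 (fun g g' => P (-g' + g) x)
      (e n).finite_toSet (e n).finite_toSet)).union
      ((e n).finite_toSet.image fun g => P (-g) (Q.symm x))) ?_
    rintro y ⟨-, ⟨g, hg, g', hg', rfl⟩ | ⟨g, hg, rfl⟩⟩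
    · exact Or.inl ⟨g, hg, g', hg', rfl⟩
    · exact Or.inr ⟨g, hg, rfl⟩
  have hxS : f x ∉ f '' S := by
    rintro ⟨y, hy, hyx⟩
    exact hy.1 (hf.injective hyx)
  obtain ⟨a, b, hxab, hab⟩ := exists_rat_Ioo_disjoint_finite (hS.image f) hxS
  have hSA : ∀ y ∈ S, y ∉ A a b := fun y hy => hab _ ⟨y, hy, rfl⟩
  refine ⟨(a, b, n), ⟨hxab, ?_⟩, fun g hg g' hg' hne =>
    disjoint_image_nonreturnSet hP0 hPadd _ hg hg' hne, ?_⟩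
  · simp only [Set.mem_iUnion, Set.mem_preimage]
    rintro ⟨g, hg, g', hg', hne, hmem⟩
    refine hSA _ ⟨hPx _ fun h => hne ?_, Or.inl ⟨g, hg, g', hg', rfl⟩⟩ hmem
    exact (neg_add_eq_zero.1 h).symm
  · simp only [Set.mem_iUnion]
    rintro ⟨g, hg, v, hv, hvx⟩
    have hveq : P (-g) (Q.symm x) = v := by
      rw [← hvx, ← hPadd, neg_add_cancel, hP0]
    refine hSA v ⟨?_, Or.inr ⟨g, hg, hveq⟩⟩ hv.1
    rintro rfl
    exact hQx g hvx.symm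
end

section
/- Let g ↦ P_g be a free measure-preserving action of a countable discrete abelian group G on a standard Borel probability space (X,μ). Then there exists a countable family 𝓕 of measurable subsets of X such that for almost every x ∈ X and every finite subset F ⊆ G with 0 ∉ F, there is a set A ∈ 𝓕 with x ∈ A and P_g x ∉ A for every g ∈ F. -/
open MeasureTheory Filter

/-- For a free measure-preserving action `P` of a countable discrete
abelian group on a standard Borel probability space there is a countable family `𝓕` of
measurable sets such that for almost every `x` and every finite `F ⊆ G` with `0 ∉ F`
some `A ∈ 𝓕` contains `x` while `P g x ∉ A` for all `g ∈ F`. -/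
theorem statement12 {X : Type*} [MeasurableSpace X] [StandardBorelSpace X]
    (μ : Measure X) [IsProbabilityMeasure μ]
    {G : Type*} [AddCommGroup G] [Countable G]
    (P : G → X → X)
    (hPmp : ∀ g, MeasurePreserving (P g) μ μ)
    (hP0 : ∀ x, P 0 x = x)
    (hPadd : ∀ g h x, P (g + h) x = P g (P h x))
    (hPfree : ∀ g : G, g ≠ 0 → ∀ᵐ x ∂μ, P g x ≠ x) :
    ∃ (I : Type) (_ : Countable I) (A : I → Set X),
      (∀ i, MeasurableSet (A i)) ∧
      ∀ᵐ x ∂μ, ∀ F : Finset G, (0 : G) ∉ F →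
        ∃ i : I, x ∈ A i ∧ ∀ g ∈ F, P g x ∉ A i := by
  let _ := upgradeStandardBorel X
  obtain ⟨A, hA⟩ := ((TopologicalSpace.countable_countableBasis X).insert
    Set.univ).exists_eq_range (Set.insert_nonempty _ _)
  refine ⟨ℕ, inferInstance, A, fun n => ?_, ?_⟩
  · obtain h | h : A n ∈ insert Set.univ (TopologicalSpace.countableBasis X) :=
      hA ▸ Set.mem_range_self n
    · exact h ▸ MeasurableSet.univ
    · exact (TopologicalSpace.isOpen_of_mem_countableBasis h).measurableSet
  · have hfree : ∀ᵐ x ∂μ, ∀ g : G, g ≠ 0 → P g x ≠ x :=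
      ae_all_iff.2 fun g => eventually_imp_distrib_left.2 (hPfree g)
    filter_upwards [hfree] with x hx F hF
    have hopen : IsOpen ((fun g => P g x) '' (F : Set G))ᶜ :=
      (F.finite_toSet.image _).isClosed.isOpen_compl
    have hmem : x ∈ ((fun g => P g x) '' (F : Set G))ᶜ := by
      rintro ⟨g, hg, hgx⟩
      exact hx g (fun h => hF (h ▸ hg)) hgx
    obtain ⟨U, hU, hxU, hUsub⟩ :=
      (TopologicalSpace.isBasis_countableBasis X).exists_subset_of_mem_open hmem hopen
    obtain ⟨n, rfl⟩ : U ∈ Set.range A := hA ▸ Set.mem_insert_of_mem _ hU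
    exact ⟨n, hxU, fun g hg hgU => hUsub hgU ⟨g, hg, rfl⟩⟩
end
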